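/- arXiv:2307.15844 — 4 statements merged into one kernel-verified Lean document; each statement's English description precedes it below -/
import Mathlib

section
/- The empirical mutual information I_EMI^{(n)} : 𝒳^n × 𝒴^n → ℝ_{≥0} satisfies the bounded differences property: for every (x, y) ∈ 𝒳^n × 𝒴^n, every index 1 ≤ i ≤ n, and every (x_i', y_i') ∈ 𝒳 × 𝒴, | I_EMI^{(n)}(x ∧ y) − I_EMI^{(n)}((x_1^{i−1}, x_i', x_{i+1}^n) ∧ (y_1^{i−1}, y_i', y_{i+1}^n)) | ≤ 6 log n / n. -/
open Classical
open scoped BigOperators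

noncomputable section

namespace EMI

/-- Empirical distribution (type) of a length-`n` sample sequence. -/
def empDist {n : ℕ} {α : Type*} [Fintype α] (s : Fin n → α) (a : α) : ℝ :=
  ((Finset.univ.filter fun t => s t = a).card : ℝ) / n

/-- Shannon entropy (base 2) of a pmf on a finite type. -/
def ent {α : Type*} [Fintype α] (q : α → ℝ) : ℝ :=
  -∑ a, q a * Real.logb 2 (q a)

/-- Empirical mutual information `I_EMI^{(n)}` computed from `n` paired samples:
entropy of the two marginal types minus entropy of the joint type. -/
def emi {n : ℕ} {𝒳 𝒴 : Type*} [Fintype 𝒳] [Fintype 𝒴] (s : Fin n → 𝒳 × 𝒴) : ℝ :=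
  ent (empDist fun t => (s t).1) + ent (empDist fun t => (s t).2) - ent (empDist s)

/-- Mutual information I(X ∧ Y) of a joint pmf on a product of finite types. -/
def miDist {𝒳 𝒴 : Type*} [Fintype 𝒳] [Fintype 𝒴] (p : 𝒳 × 𝒴 → ℝ) : ℝ :=
  ent (fun a => ∑ b, p (a, b)) + ent (fun b => ∑ a, p (a, b)) - ent p

/-- The i.i.d. product pmf of `n` samples from `p`. -/
def prodP {n : ℕ} {α : Type*} [Fintype α] (p : α → ℝ) (ω : Fin n → α) : ℝ :=
  ∏ t, p (ω t)

/-- Expectation with respect to a pmf `P` on a finite sample space. -/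
def expect {Ω : Type*} [Fintype Ω] (P : Ω → ℝ) (f : Ω → ℝ) : ℝ := ∑ ω, P ω * f ω

/-- Probability of an event with respect to a pmf `P` on a finite sample space. -/
def probEvent {Ω : Type*} [Fintype Ω] (P : Ω → ℝ) (s : Ω → Prop) : ℝ :=
  ∑ ω, if s ω then P ω else 0


/-- The increments of `k ↦ k log k` over the naturals are nonnegative and at most `2 log (k + 1)`. -/
theorem increment_mul_log_mem (k : ℕ) :
    0 ≤ ((k + 1 : ℕ) : ℝ) * Real.log (k + 1 : ℕ) - k * Real.log k ∧
      ((k + 1 : ℕ) : ℝ) * Real.log (k + 1 : ℕ) - k * Real.log k ≤ 2 * Real.log (k + 1 : ℕ) := by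
  rcases Nat.eq_zero_or_pos k with rfl | hk
  · simp
  have hk1 : (1 : ℝ) ≤ k := by exact_mod_cast hk
  have hk0 : (0 : ℝ) < k := by linarith
  have hlog : 0 ≤ Real.log k := Real.log_nonneg hk1
  have hmono : Real.log k ≤ Real.log (k + 1) := Real.log_le_log hk0 (by linarith)
  push_cast
  refine ⟨by nlinarith, ?_⟩
  have hratio : Real.log (k + 1) - Real.log k ≤ (k : ℝ)⁻¹ := by
    rw [← Real.log_div (by positivity) hk0.ne']
    refine (Real.log_le_sub_one_of_pos (by positivity)).trans (le_of_eq ?_)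
    field_simp
    ring
  have hlower : 1 - (k : ℝ)⁻¹ ≤ Real.log k := Real.one_sub_inv_le_log_of_pos hk0
  have hinv : (k : ℝ) * (k : ℝ)⁻¹ = 1 := mul_inv_cancel₀ hk0.ne'
  nlinarith [mul_le_mul_of_nonneg_left hratio (sub_nonneg.2 hk1)]

theorem increment_mul_logb_mem {k n : ℕ} (hkn : k + 1 ≤ n) :
    0 ≤ ((k + 1 : ℕ) : ℝ) * Real.logb 2 (k + 1 : ℕ) - k * Real.logb 2 k ∧
      ((k + 1 : ℕ) : ℝ) * Real.logb 2 (k + 1 : ℕ) - k * Real.logb 2 k ≤ 2 * Real.logb 2 n := by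
  have h2 : 0 < Real.log 2 := Real.log_pos (by norm_num)
  obtain ⟨h₀, h₁⟩ := increment_mul_log_mem k
  have hle : Real.log (k + 1 : ℕ) ≤ Real.log n :=
    Real.log_le_log (by positivity) (by exact_mod_cast hkn)
  simp only [Real.logb, ← mul_div_assoc, ← sub_div]
  exact ⟨div_nonneg h₀ h2.le, div_le_div_of_nonneg_right (by linarith) h2.le⟩

theorem ent_empDist_eq {n : ℕ} (hn : n ≠ 0) {α : Type*} [Fintype α] (s : Fin n → α) :
    ent (empDist s) = Real.logb 2 n -
      (∑ a, ((Finset.univ.filter fun t => s t = a).card : ℝ) *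
        Real.logb 2 (Finset.univ.filter fun t => s t = a).card) / n := by
  have hn' : (n : ℝ) ≠ 0 := by exact_mod_cast hn
  have hsum : ∑ a, ((Finset.univ.filter fun t => s t = a).card : ℝ) = n := by
    have := Finset.card_eq_sum_card_fiberwise (s := Finset.univ) (t := Finset.univ) (f := s)
      (by simp)
    rw [Finset.card_univ, Fintype.card_fin] at this
    exact_mod_cast this.symm
  have hterm (a : α) : empDist s a * Real.logb 2 (empDist s a) =
      ((Finset.univ.filter fun t => s t = a).card : ℝ) *
        Real.logb 2 (Finset.univ.filter fun t => s t = a).card / n -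
      ((Finset.univ.filter fun t => s t = a).card : ℝ) * (Real.logb 2 n / n) := by
    unfold empDist
    by_cases hc : ((Finset.univ.filter fun t => s t = a).card : ℝ) = 0
    · simp [hc]
    · rw [Real.logb_div hc hn']
      ring
  simp only [ent, hterm]
  rw [Finset.sum_sub_distrib, ← Finset.sum_div, ← Finset.sum_mul, hsum]
  field_simp
  ring

/-- Separating the contribution of the coordinate `i` to a sum over symbol counts. -/
theorem sum_card_fiber_eq {n : ℕ} {α : Type*} [Fintype α] (s : Fin n → α) (i : Fin n)
    (h : ℕ → ℝ) :
    ∑ a, h (Finset.univ.filter fun t => s t = a).card =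
      ∑ a, h (Finset.univ.filter fun t => t ≠ i ∧ s t = a).card +
        (h ((Finset.univ.filter fun t => t ≠ i ∧ s t = s i).card + 1) -
          h (Finset.univ.filter fun t => t ≠ i ∧ s t = s i).card) := by
  rw [← sub_eq_iff_eq_add', ← Finset.sum_sub_distrib, Finset.sum_eq_single (s i)]
  · congr 2
    rw [← Finset.card_insert_of_notMem (a := i) (by simp)]
    congr 1
    ext t
    by_cases ht : t = i <;> simp [ht]
  · intro a _ ha
    rw [sub_eq_zero]
    congr 2
    ext t
    by_cases ht : t = i
    · subst ht
      simp [ha.symm]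
    · simp [ht]
  · simp

theorem abs_ent_empDist_sub_update_le {n : ℕ} {α : Type*} [Fintype α] (s : Fin n → α)
    (i : Fin n) (v : α) :
    |ent (empDist s) - ent (empDist (Function.update s i v))| ≤ 2 * Real.logb 2 n / n := by
  have hn : n ≠ 0 := i.pos.ne'
  have hrest (a : α) : (Finset.univ.filter fun t => t ≠ i ∧ Function.update s i v t = a) =
      Finset.univ.filter fun t => t ≠ i ∧ s t = a := by
    ext t
    by_cases ht : t = i <;> simp [ht]
  have hcard (a : α) : (Finset.univ.filter fun t => t ≠ i ∧ s t = a).card + 1 ≤ n := by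
    rw [← Finset.card_insert_of_notMem (a := i) (by simp)]
    simpa using Finset.card_le_univ (insert i (Finset.univ.filter fun t => t ≠ i ∧ s t = a))
  rw [ent_empDist_eq hn, ent_empDist_eq hn,
    sum_card_fiber_eq s i fun k => (k : ℝ) * Real.logb 2 k,
    sum_card_fiber_eq (Function.update s i v) i fun k => (k : ℝ) * Real.logb 2 k]
  simp only [hrest, Function.update_self]
  obtain ⟨h₀, h₁⟩ := increment_mul_logb_mem (hcard (s i))
  obtain ⟨h₂, h₃⟩ := increment_mul_logb_mem (hcard v)
  rw [sub_sub_sub_cancel_left, ← sub_div, add_sub_add_left_eq_sub, abs_div, Nat.abs_cast]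
  exact div_le_div_of_nonneg_right (abs_le.2 ⟨by linarith, by linarith⟩) n.cast_nonneg

/-- bounded differences for empirical mutual information. Changing a
single sample pair changes I_EMI^{(n)} by at most 6·log n / n (logarithm base 2). -/
theorem emi_bounded_differences {𝒳 𝒴 : Type*} [Fintype 𝒳] [Fintype 𝒴] {n : ℕ}
    (s : Fin n → 𝒳 × 𝒴) (i : Fin n) (v : 𝒳 × 𝒴) :
    |emi s - emi (Function.update s i v)| ≤ 6 * Real.logb 2 n / n := by
  have hfst : (fun t => (Function.update s i v t).1) =
      Function.update (fun t => (s t).1) i v.1 := Function.comp_update Prod.fst s i v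
  have hsnd : (fun t => (Function.update s i v t).2) =
      Function.update (fun t => (s t).2) i v.2 := Function.comp_update Prod.snd s i v
  have h₁ := abs_le.1 (abs_ent_empDist_sub_update_le (fun t => (s t).1) i v.1)
  have h₂ := abs_le.1 (abs_ent_empDist_sub_update_le (fun t => (s t).2) i v.2)
  have h₃ := abs_le.1 (abs_ent_empDist_sub_update_le s i v)
  have hsplit : 6 * Real.logb 2 n / n = 3 * (2 * Real.logb 2 n / n) := by ring
  rw [hsplit, emi, emi, hfst, hsnd, abs_le]
  exact ⟨by linarith, by linarith⟩

end EMI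
end
end

section
/- Let (X_t, Y_t)_{t=1}^n, n ≥ 2, be i.i.d. samples from a pmf P_{XY} with full support on the finite set 𝒳 × 𝒴. Then for every ε > 0, P( I_EMI^{(n)}(X ∧ Y) − E[I_EMI^{(n)}(X ∧ Y)] ≥ ε ) ≤ exp( −2 n ε² / (36 log² n) ), and the same bound holds with I_EMI^{(n)}(X ∧ Y) replaced by −I_EMI^{(n)}(X ∧ Y). -/
open Classical
open scoped BigOperators

noncomputable section

namespace EMI

open MeasureTheory ProbabilityTheory in
/-- **Hoeffding's lemma** for a function of bounded oscillation on a finite probability space. -/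
theorem expect_exp_le {α : Type*} [Fintype α] {p : α → ℝ} (hp0 : ∀ a, 0 ≤ p a)
    (hp1 : ∑ a, p a = 1) {f : α → ℝ} {c : ℝ} (hf : ∀ a b, f a - f b ≤ c) (l : ℝ) :
    expect p (fun a => Real.exp (l * (f a - expect p f))) ≤ Real.exp (l ^ 2 * c ^ 2 / 8) := by
  have hne : Nonempty α := by
    by_contra h
    rw [not_nonempty_iff] at h
    simp at hp1
  obtain ⟨m, hm⟩ := Finite.exists_min f
  let q : PMF α := PMF.ofFintype (fun a => ENNReal.ofReal (p a)) (by
    rw [← ENNReal.ofReal_sum_of_nonneg fun a _ => hp0 a, hp1, ENNReal.ofReal_one])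
  let _ : MeasurableSpace α := ⊤
  have hq : ∀ g : α → ℝ, ∫ a, g a ∂q.toMeasure = expect p g := fun g => by
    rw [PMF.integral_eq_sum]
    simp [expect, q, hp0]
  have h := (hasSubgaussianMGF_of_mem_Icc (μ := q.toMeasure) (X := f) (a := f m) (b := f m + c)
    (measurable_from_top.aemeasurable)
    (Filter.Eventually.of_forall fun a => ⟨hm a, by linarith [hf a m]⟩)).mgf_le l
  rw [mgf, hq, hq] at h
  refine h.trans (le_of_eq ?_)
  congr 1
  simp [div_pow]
  ring

theorem expect_prodP_succ {α : Type*} [Fintype α] (p : α → ℝ) {n : ℕ}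
    (f : (Fin (n + 1) → α) → ℝ) :
    expect (prodP p) f =
      expect (prodP p) (fun ω : Fin n → α => expect p fun a => f (Fin.cons a ω)) := by
  unfold expect
  rw [← (Fin.consEquiv fun _ => α).sum_comp, Fintype.sum_prod_type_right]
  refine Finset.sum_congr rfl fun ω _ => ?_
  rw [Finset.mul_sum]
  refine Finset.sum_congr rfl fun a _ => ?_
  simp [Fin.consEquiv, prodP, Fin.prod_univ_succ]
  ring

theorem expect_mono {Ω : Type*} [Fintype Ω] {P : Ω → ℝ} (hP : ∀ ω, 0 ≤ P ω) {f g : Ω → ℝ}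
    (h : ∀ ω, f ω ≤ g ω) : expect P f ≤ expect P g :=
  Finset.sum_le_sum fun ω _ => mul_le_mul_of_nonneg_left (h ω) (hP ω)

theorem expect_mul_const {Ω : Type*} [Fintype Ω] (P f : Ω → ℝ) (c : ℝ) :
    expect P (fun ω => f ω * c) = expect P f * c := by
  simp [expect, Finset.sum_mul, mul_assoc]

theorem prodP_nonneg {α : Type*} [Fintype α] {p : α → ℝ} (hp0 : ∀ a, 0 ≤ p a) {n : ℕ}
    (ω : Fin n → α) : 0 ≤ prodP p ω :=
  Finset.prod_nonneg fun _ _ => hp0 _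

/-- Moment generating function bound for functions with bounded differences. -/
theorem expect_prodP_exp_le {α : Type*} [Fintype α] {p : α → ℝ} (hp0 : ∀ a, 0 ≤ p a)
    (hp1 : ∑ a, p a = 1) {c : ℝ} (l : ℝ) {n : ℕ} (f : (Fin n → α) → ℝ)
    (hf : ∀ t ω ω', (∀ i, i ≠ t → ω i = ω' i) → f ω - f ω' ≤ c) :
    expect (prodP p) (fun ω => Real.exp (l * (f ω - expect (prodP p) f)))
      ≤ Real.exp (n * (l ^ 2 * c ^ 2 / 8)) := by
  induction n with
  | zero => simp [expect, prodP]
  | succ n ih =>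
    set g : (Fin n → α) → ℝ := fun ω => expect p fun a => f (Fin.cons a ω) with hg
    have hfg : expect (prodP p) f = expect (prodP p) g := expect_prodP_succ p f
    have hgc : ∀ t ω ω', (∀ i, i ≠ t → ω i = ω' i) → g ω - g ω' ≤ c := by
      intro t ω ω' h
      have hc : c = ∑ a, p a * c := by rw [← Finset.sum_mul, hp1, one_mul]
      rw [hc, hg]
      simp only [expect]
      rw [← Finset.sum_sub_distrib]
      refine Finset.sum_le_sum fun a _ => ?_
      rw [← mul_sub]
      refine mul_le_mul_of_nonneg_left (hf t.succ _ _ fun i hi => ?_) (hp0 a)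
      cases i using Fin.cases with
      | zero => simp
      | succ i => simpa using h i fun e => hi (by rw [e])
    rw [expect_prodP_succ, hfg]
    calc expect (prodP p) (fun ω : Fin n → α => expect p fun a =>
            Real.exp (l * (f (Fin.cons a ω) - expect (prodP p) g)))
        ≤ expect (prodP p) (fun ω : Fin n → α =>
            Real.exp (l * (g ω - expect (prodP p) g)) * Real.exp (l ^ 2 * c ^ 2 / 8)) := by
          refine expect_mono (prodP_nonneg hp0) fun ω => ?_
          have h := expect_exp_le hp0 hp1 (f := fun a => f (Fin.cons a ω)) (c := c)
            (fun a b => hf 0 _ _ fun i hi => by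
              obtain ⟨j, rfl⟩ := Fin.exists_succ_eq_of_ne_zero hi
              simp) l
          refine le_trans (le_of_eq ?_) (mul_le_mul_of_nonneg_left h (Real.exp_pos _).le)
          rw [mul_comm, ← expect_mul_const]
          congr 1
          ext a
          rw [← Real.exp_add]
          congr 1
          ring
      _ ≤ Real.exp (n * (l ^ 2 * c ^ 2 / 8)) * Real.exp (l ^ 2 * c ^ 2 / 8) := by
          rw [expect_mul_const]
          exact mul_le_mul_of_nonneg_right (ih g hgc) (Real.exp_pos _).le
      _ = Real.exp ((n + 1 : ℕ) * (l ^ 2 * c ^ 2 / 8)) := by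
          rw [← Real.exp_add]
          congr 1
          push_cast
          ring

/-- **McDiarmid's inequality** for i.i.d. samples from a pmf on a finite type. -/
theorem probEvent_sub_expect_ge_le {α : Type*} [Fintype α] {p : α → ℝ} (hp0 : ∀ a, 0 ≤ p a)
    (hp1 : ∑ a, p a = 1) {c : ℝ} (hc : 0 < c) {n : ℕ} (hn : 0 < n) (f : (Fin n → α) → ℝ)
    (hf : ∀ t ω ω', (∀ i, i ≠ t → ω i = ω' i) → f ω - f ω' ≤ c) {ε : ℝ} (hε : 0 < ε) :
    probEvent (prodP p) (fun ω => f ω - expect (prodP p) f ≥ ε)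
      ≤ Real.exp (-(2 * ε ^ 2) / (n * c ^ 2)) := by
  have hn' : (0 : ℝ) < n := by exact_mod_cast hn
  set l : ℝ := 4 * ε / (n * c ^ 2) with hl
  have hl0 : 0 ≤ l := by positivity
  calc probEvent (prodP p) (fun ω => f ω - expect (prodP p) f ≥ ε)
      ≤ expect (prodP p) (fun ω =>
          Real.exp (l * (f ω - expect (prodP p) f)) * Real.exp (-(l * ε))) := by
        refine Finset.sum_le_sum fun ω _ => ?_
        simp only [← Real.exp_add]
        split_ifs with h
        · refine le_mul_of_one_le_right (prodP_nonneg hp0 ω) (Real.one_le_exp ?_)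
          nlinarith
        · exact mul_nonneg (prodP_nonneg hp0 ω) (Real.exp_pos _).le
    _ ≤ Real.exp (n * (l ^ 2 * c ^ 2 / 8)) * Real.exp (-(l * ε)) := by
        rw [expect_mul_const]
        exact mul_le_mul_of_nonneg_right (expect_prodP_exp_le hp0 hp1 l f hf) (Real.exp_pos _).le
    _ = Real.exp (-(2 * ε ^ 2) / (n * c ^ 2)) := by
        rw [← Real.exp_add]
        congr 1
        rw [hl]
        field_simp
        ring

theorem mul_logb_le_succ {k : ℕ} :
    (k : ℝ) * Real.logb 2 k ≤ (k + 1 : ℕ) * Real.logb 2 (k + 1 : ℕ) := by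
  rcases Nat.eq_zero_or_pos k with rfl | hk
  · simp
  have hk' : (0 : ℝ) < k := by exact_mod_cast hk
  have h : Real.logb 2 k ≤ Real.logb 2 (k + 1 : ℕ) :=
    Real.logb_le_logb_of_le one_lt_two hk' (by push_cast; linarith)
  have h0 : 0 ≤ Real.logb 2 k := Real.logb_nonneg one_lt_two (by exact_mod_cast hk)
  refine mul_le_mul (by push_cast; linarith) h h0 (by positivity)

theorem succ_mul_logb_le {k : ℕ} :
    ((k + 1 : ℕ) : ℝ) * Real.logb 2 (k + 1 : ℕ)
      ≤ k * Real.logb 2 k + 2 * Real.logb 2 (k + 1 : ℕ) := by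
  rcases Nat.eq_zero_or_pos k with rfl | hk
  · simp
  have hk' : (0 : ℝ) < k := by exact_mod_cast hk
  have hk1 : (1 : ℝ) ≤ k := by exact_mod_cast hk
  have h := strictConcaveOn_log_Ioi.concaveOn.2
    (Set.mem_Ioi.2 one_pos) (Set.mem_Ioi.2 (by linarith : (0 : ℝ) < k + 1))
    (by positivity : (0 : ℝ) ≤ 1 / k) (div_nonneg (by linarith) hk'.le : (0 : ℝ) ≤ (k - 1) / k)
    (by field_simp; ring)
  have e : (1 / (k : ℝ)) • (1 : ℝ) + ((k - 1) / (k : ℝ)) • ((k : ℝ) + 1) = k := by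
    simp only [smul_eq_mul]
    field_simp
    ring
  rw [e] at h
  simp only [smul_eq_mul, Real.log_one, mul_zero, zero_add] at h
  rw [div_mul_eq_mul_div, div_le_iff₀ hk'] at h
  have h2 : 0 < Real.log 2 := Real.log_pos one_lt_two
  push_cast
  simp only [Real.logb]
  rw [← sub_nonneg]
  have : (k : ℝ) * (Real.log k / Real.log 2) + 2 * (Real.log (k + 1) / Real.log 2)
      - (k + 1) * (Real.log (k + 1) / Real.log 2)
      = (Real.log k * k - (k - 1) * Real.log (k + 1)) / Real.log 2 := by ring
  rw [this]
  exact div_nonneg (by linarith) h2.le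

theorem ent_empDist {n : ℕ} (hn : 0 < n) {α : Type*} [Fintype α] (s : Fin n → α) :
    ent (empDist s) = Real.logb 2 n - (∑ a, ((Finset.univ.filter fun t => s t = a).card : ℝ) *
      Real.logb 2 (Finset.univ.filter fun t => s t = a).card) / n := by
  have hn' : (n : ℝ) ≠ 0 := by exact_mod_cast hn.ne'
  have hs : ∑ a, ((Finset.univ.filter fun t => s t = a).card : ℝ) = n := by
    have := Finset.card_eq_sum_card_fiberwise (f := s) (s := Finset.univ) (t := Finset.univ)
      (fun _ _ => Finset.mem_coe.2 (Finset.mem_univ _))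
    rw [Finset.card_univ, Fintype.card_fin] at this
    exact_mod_cast this.symm
  have key : ∀ a, empDist s a * Real.logb 2 (empDist s a) =
      ((Finset.univ.filter fun t => s t = a).card : ℝ) *
        Real.logb 2 (Finset.univ.filter fun t => s t = a).card / n
      - ((Finset.univ.filter fun t => s t = a).card : ℝ) * (Real.logb 2 n / n) := by
    intro a
    unfold empDist
    by_cases h : ((Finset.univ.filter fun t => s t = a).card : ℝ) = 0
    · simp [h]
    · rw [Real.logb_div h hn']
      ring
  simp only [ent, key, Finset.sum_sub_distrib, ← Finset.sum_mul, ← Finset.sum_div, hs]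
  field_simp
  ring

/-- The sum of `k log k` over the counts `k` of a sample, split at the position `t`. -/
theorem sum_count_mul_logb_eq {n : ℕ} {α : Type*} [Fintype α] (s : Fin n → α) (t : Fin n)
    (g : ℕ → ℝ) :
    ∑ a, g (Finset.univ.filter fun i => s i = a).card =
      ∑ a, g (Finset.univ.filter fun i => i ≠ t ∧ s i = a).card +
        (g ((Finset.univ.filter fun i => i ≠ t ∧ s i = s t).card + 1) -
          g (Finset.univ.filter fun i => i ≠ t ∧ s i = s t).card) := by
  have hself : (Finset.univ.filter fun i => s i = s t).card =
      (Finset.univ.filter fun i => i ≠ t ∧ s i = s t).card + 1 := by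
    rw [← Finset.card_insert_of_notMem (a := t) (by simp)]
    congr 1
    ext i
    by_cases h : i = t <;> simp [h]
  have hother : ∀ a, a ≠ s t → (Finset.univ.filter fun i => s i = a).card =
      (Finset.univ.filter fun i => i ≠ t ∧ s i = a).card := by
    intro a ha
    congr 1
    ext i
    by_cases h : i = t
    · simp [h, ha.symm]
    · simp [h]
  rw [← sub_eq_iff_eq_add', ← Finset.sum_sub_distrib, Finset.sum_eq_single (s t), hself]
  · intro a _ ha
    rw [hother a ha, sub_self]
  · simp

/-- Changing one sample changes the empirical entropy by at most `2 log n / n`. -/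
theorem ent_empDist_sub_le {n : ℕ} {α : Type*} [Fintype α] (t : Fin n) (s s' : Fin n → α)
    (h : ∀ i, i ≠ t → s i = s' i) :
    ent (empDist s) - ent (empDist s') ≤ 2 * Real.logb 2 n / n := by
  have hn : 0 < n := t.pos
  have hn' : (0 : ℝ) < n := by exact_mod_cast hn
  have hM : ∀ a, (Finset.univ.filter fun i => i ≠ t ∧ s i = a) =
      Finset.univ.filter fun i => i ≠ t ∧ s' i = a := by
    intro a
    ext i
    by_cases hi : i = t
    · simp [hi]
    · simp [hi, h i hi]
  have hle : (Finset.univ.filter fun i => i ≠ t ∧ s' i = s' t).card + 1 ≤ n := by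
    rw [← Finset.card_insert_of_notMem (a := t) (by simp)]
    exact (Finset.card_le_univ _).trans_eq (Fintype.card_fin n)
  rw [ent_empDist hn, ent_empDist hn, sub_sub_sub_cancel_left, ← sub_div]
  refine div_le_div_of_nonneg_right ?_ hn'.le
  rw [sum_count_mul_logb_eq s t fun k => (k : ℝ) * Real.logb 2 k,
    sum_count_mul_logb_eq s' t fun k => (k : ℝ) * Real.logb 2 k]
  simp only [hM]
  have h1 := mul_logb_le_succ (k := (Finset.univ.filter fun i => i ≠ t ∧ s' i = s t).card)
  have h2 := succ_mul_logb_le (k := (Finset.univ.filter fun i => i ≠ t ∧ s' i = s' t).card)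
  have h3 : Real.logb 2 ((Finset.univ.filter fun i => i ≠ t ∧ s' i = s' t).card + 1 : ℕ)
      ≤ Real.logb 2 n :=
    Real.logb_le_logb_of_le one_lt_two (by positivity) (by exact_mod_cast hle)
  linarith

/-- Changing one sample changes the empirical mutual information by at most `6 log n / n`. -/
theorem emi_sub_le {n : ℕ} {𝒳 𝒴 : Type*} [Fintype 𝒳] [Fintype 𝒴] (t : Fin n)
    (s s' : Fin n → 𝒳 × 𝒴) (h : ∀ i, i ≠ t → s i = s' i) :
    emi s - emi s' ≤ 6 * Real.logb 2 n / n := by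
  have h1 := ent_empDist_sub_le t (fun i => (s i).1) (fun i => (s' i).1)
    fun i hi => by simp only [h i hi]
  have h2 := ent_empDist_sub_le t (fun i => (s i).2) (fun i => (s' i).2)
    fun i hi => by simp only [h i hi]
  have h3 := ent_empDist_sub_le t s' s fun i hi => (h i hi).symm
  have e : 6 * Real.logb 2 n / n = 3 * (2 * Real.logb 2 n / n) := by ring
  unfold emi
  rw [e]
  linarith

/-- concentration of empirical mutual information. For n ≥ 2 i.i.d.
samples from a full-support pmf and every ε > 0,
P(I_EMI^{(n)} − E[I_EMI^{(n)}] ≥ ε) ≤ exp(−2nε²/(36 log² n)), and likewise for −I_EMI^{(n)}. -/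
theorem emi_concentration {𝒳 𝒴 : Type*} [Fintype 𝒳] [Fintype 𝒴] {n : ℕ} (hn : 2 ≤ n)
    (p : 𝒳 × 𝒴 → ℝ) (hp0 : ∀ ab, 0 < p ab) (hp1 : ∑ ab, p ab = 1)
    (ε : ℝ) (hε : 0 < ε) :
    probEvent (prodP p) (fun ω : Fin n → 𝒳 × 𝒴 =>
        emi ω - expect (prodP p) (fun ω' : Fin n → 𝒳 × 𝒴 => emi ω') ≥ ε)
      ≤ Real.exp (-(2 * n * ε ^ 2) / (36 * Real.logb 2 n ^ 2))
    ∧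
    probEvent (prodP p) (fun ω : Fin n → 𝒳 × 𝒴 =>
        (-emi ω) - expect (prodP p) (fun ω' : Fin n → 𝒳 × 𝒴 => -emi ω') ≥ ε)
      ≤ Real.exp (-(2 * n * ε ^ 2) / (36 * Real.logb 2 n ^ 2)) := by
  have hn0 : 0 < n := by omega
  have hn' : (0 : ℝ) < n := by exact_mod_cast hn0
  have hlog : 0 < Real.logb 2 n := Real.logb_pos one_lt_two (by exact_mod_cast hn)
  have hc : 0 < 6 * Real.logb 2 n / n := by positivity
  have e : -(2 * n * ε ^ 2) / (36 * Real.logb 2 n ^ 2) =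
      -(2 * ε ^ 2) / (n * (6 * Real.logb 2 n / n) ^ 2) := by
    field_simp
    ring
  rw [e]
  refine ⟨probEvent_sub_expect_ge_le (fun ab => (hp0 ab).le) hp1 hc hn0 emi emi_sub_le hε,
    probEvent_sub_expect_ge_le (fun ab => (hp0 ab).le) hp1 hc hn0 (fun ω => -emi ω)
      (fun t ω ω' h => ?_) hε⟩
  have := emi_sub_le t ω' ω fun i hi => (h i hi).symm
  linarith

end EMI
end
end

section
/- Consider estimating the minimizing edge of a Markov chain on a tree from uniform sampling: each pair (X_i, X_j), (i,j) ∈ E, is sampled n = N/|E| times i.i.d. over nonoverlapping time instants, and the estimate is ê_N = argmin_{(i,j)∈E} I_EMI^{(n)}(i ∧ j). Then the probability of error in identifying the optimal pair of arms satisfies P( ê_N ≠ (ī, j̄) ) ≤ 2 |E| exp( −(N/|E|) Δ_1² / (648 log²(N/|E|)) ) for all N > |E| max{ (|𝒳|²−1)/(2^{Δ_1/3}−1), (|𝒳|−1)/(2^{Δ_1/6}−1) }. -/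
open Classical
open scoped BigOperators

noncomputable section

namespace MCT

variable {m : ℕ}

/-- Marginal pmf of the coordinates in `A`. -/
def marg (𝒳 : Fin m → Type) [∀ i, Fintype (𝒳 i)]
    (p : (∀ i, 𝒳 i) → ℝ) (A : Finset (Fin m)) (y : (i : A) → 𝒳 i.1) : ℝ :=
  ∑ x : (i : Fin m) → 𝒳 i, if ∀ i : A, x i.1 = y i then p x else 0

/-- Shannon entropy (base 2) of the collection `X_A`. -/
def ent (𝒳 : Fin m → Type) [∀ i, Fintype (𝒳 i)]
    (p : (∀ i, 𝒳 i) → ℝ) (A : Finset (Fin m)) : ℝ :=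
  -∑ y : (i : A) → 𝒳 i.1, marg 𝒳 p A y * Real.logb 2 (marg 𝒳 p A y)

/-- Mutual information I(X_A ∧ X_B). -/
def mutI (𝒳 : Fin m → Type) [∀ i, Fintype (𝒳 i)]
    (p : (∀ i, 𝒳 i) → ℝ) (A B : Finset (Fin m)) : ℝ :=
  ent 𝒳 p A + ent 𝒳 p B - ent 𝒳 p (A ∪ B)

/-- Conditional mutual information I(X_A ∧ X_B | X_S). -/
def cmi (𝒳 : Fin m → Type) [∀ i, Fintype (𝒳 i)]
    (p : (∀ i, 𝒳 i) → ℝ) (A B S : Finset (Fin m)) : ℝ :=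
  ent 𝒳 p (A ∪ S) + ent 𝒳 p (B ∪ S) - ent 𝒳 p (A ∪ B ∪ S) - ent 𝒳 p S

/-- `side G i j` = B(i←j): vertices connected to `j` by a path containing edge (i,j),
equivalently the vertices on `i`'s side once edge (i,j) is removed. -/
def side {V : Type*} [Fintype V] (G : SimpleGraph V) (i j : V) : Finset V :=
  Finset.univ.filter fun k => (G.deleteEdges {s(i, j)}).Reachable k i

/-- Markov chain on a tree: for each edge (i,j), X_j ⊥ X_{B(i←j)\{i}} | X_i. -/
def IsMCT (𝒳 : Fin m → Type) [∀ i, Fintype (𝒳 i)] (G : SimpleGraph (Fin m))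
    (p : (∀ i, 𝒳 i) → ℝ) : Prop :=
  ∀ i j : Fin m, G.Adj i j → cmi 𝒳 p {j} ((side G i j).erase i) {i} = 0

/-- A partition of {1,…,m} into nonempty pairwise disjoint atoms covering everything. -/
def IsPartition (π : Finset (Finset (Fin m))) : Prop :=
  (∀ a ∈ π, a.Nonempty) ∧ ((π : Set (Finset (Fin m))).PairwiseDisjoint id) ∧
    π.sup id = Finset.univ

/-- I(π) = (1/(|π|−1))·[Σ_{a∈π} H(X_a) − H(X_M)]. -/
def cI (𝒳 : Fin m → Type) [∀ i, Fintype (𝒳 i)]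
    (p : (∀ i, 𝒳 i) → ℝ) (π : Finset (Finset (Fin m))) : ℝ :=
  ((π.card : ℝ) - 1)⁻¹ * ((∑ a ∈ π, ent 𝒳 p a) - ent 𝒳 p Finset.univ)

/-- Shared information: minimum of I(π) over partitions with at least two atoms. -/
def SI (𝒳 : Fin m → Type) [∀ i, Fintype (𝒳 i)] (p : (∀ i, 𝒳 i) → ℝ) : ℝ :=
  sInf {r | ∃ π : Finset (Finset (Fin m)), IsPartition π ∧ 2 ≤ π.card ∧ r = cI 𝒳 p π}

end MCT

namespace SIEst

open MCT EMI

/-- The pairwise marginal pmf P_{X_i X_j} of a joint pmf on `Fin m → 𝒳`. -/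
def pairP {m : ℕ} {𝒳 : Type*} [Fintype 𝒳] (p : (Fin m → 𝒳) → ℝ) (i j : Fin m)
    (ab : 𝒳 × 𝒳) : ℝ :=
  ∑ x : Fin m → 𝒳, if x i = ab.1 ∧ x j = ab.2 then p x else 0


lemma sum_fin_succ_fun {n : ℕ} {α : Type*} [Fintype α] (F : (Fin (n + 1) → α) → ℝ) :
    ∑ ω, F ω = ∑ a, ∑ ω : Fin n → α, F (Fin.cons a ω) := by
  rw [← Fintype.sum_prod_type', ← (Fin.consEquiv fun _ => α).sum_comp]
  rfl

lemma prodP_cons {n : ℕ} {α : Type*} [Fintype α] (p : α → ℝ) (a : α) (ω : Fin n → α) :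
    prodP p (Fin.cons a ω : Fin (n + 1) → α) = p a * prodP p ω := by
  simp [prodP, Fin.prod_univ_succ]

lemma prodP_nonneg {n : ℕ} {α : Type*} [Fintype α] {p : α → ℝ} (hp : ∀ a, 0 ≤ p a)
    (ω : Fin n → α) : 0 ≤ prodP p ω :=
  Finset.prod_nonneg fun _ _ => hp _

lemma sum_prodP {n : ℕ} {α : Type*} [Fintype α] {p : α → ℝ} (hp : ∑ a, p a = 1) :
    ∑ ω : Fin n → α, prodP p ω = 1 := by
  simp only [prodP]
  rw [← Fintype.prod_sum (fun (_ : Fin n) a => p a)]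
  simp [hp]

lemma expect_prodP_succ {n : ℕ} {α : Type*} [Fintype α] (p : α → ℝ)
    (f : (Fin (n + 1) → α) → ℝ) :
    expect (prodP p) f =
      expect p fun a => expect (prodP p) fun ω : Fin n → α => f (Fin.cons a ω) := by
  simp only [expect, sum_fin_succ_fun, prodP_cons, Finset.mul_sum, mul_assoc]

section Expect

variable {Ω : Type*} [Fintype Ω] {P : Ω → ℝ}

lemma expect_mono (hP : ∀ ω, 0 ≤ P ω) {f g : Ω → ℝ} (h : ∀ ω, f ω ≤ g ω) :
    expect P f ≤ expect P g :=
  Finset.sum_le_sum fun ω _ => mul_le_mul_of_nonneg_left (h ω) (hP ω)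

lemma expect_const (hP : ∑ ω, P ω = 1) (c : ℝ) : expect P (fun _ => c) = c := by
  simp [expect, ← Finset.sum_mul, hP]

lemma expect_add (f g : Ω → ℝ) :
    expect P (fun ω => f ω + g ω) = expect P f + expect P g := by
  simp [expect, mul_add, Finset.sum_add_distrib]

lemma expect_sub (f g : Ω → ℝ) :
    expect P (fun ω => f ω - g ω) = expect P f - expect P g := by
  simp [expect, mul_sub, Finset.sum_sub_distrib]

lemma expect_mul_left (c : ℝ) (f : Ω → ℝ) :
    expect P (fun ω => c * f ω) = c * expect P f := by
  simp [expect, Finset.mul_sum, mul_left_comm]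

lemma expect_sum {ι : Type*} [Fintype ι] (f : ι → Ω → ℝ) :
    expect P (fun ω => ∑ i, f i ω) = ∑ i, expect P (f i) := by
  simp only [expect, Finset.mul_sum]
  exact Finset.sum_comm

/-- **Hoeffding's lemma** for a pmf on a finite type. -/
lemma expect_exp_le_of_abs_sub_le (hP : ∀ ω, 0 ≤ P ω) (hP1 : ∑ ω, P ω = 1) {g : Ω → ℝ} {c : ℝ}
    (hc : ∀ a b, |g a - g b| ≤ c) :
    expect P (fun ω => Real.exp (g ω)) ≤ Real.exp (expect P g + c ^ 2 / 8) := by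
  have : Nonempty Ω := by
    by_contra h
    simp [not_nonempty_iff.mp h] at hP1
  obtain ⟨a₀, ha₀⟩ := Finite.exists_min g
  have hc0 : 0 ≤ c := (abs_nonneg _).trans (hc a₀ a₀)
  let _ : MeasurableSpace Ω := ⊤
  have hsum : ∑ ω, ENNReal.ofReal (P ω) = 1 := by
    rw [← ENNReal.ofReal_sum_of_nonneg fun ω _ => hP ω, hP1, ENNReal.ofReal_one]
  have hint : ∀ f : Ω → ℝ,
      ∫ ω, f ω ∂(PMF.ofFintype (fun ω => ENNReal.ofReal (P ω)) hsum).toMeasure = expect P f := by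
    intro f
    rw [PMF.integral_eq_sum]
    simp [expect, hP]
  have key := ProbabilityTheory.hasSubgaussianMGF_of_mem_Icc
    (μ := (PMF.ofFintype (fun ω => ENNReal.ofReal (P ω)) hsum).toMeasure)
    (X := g) (a := g a₀) (b := g a₀ + c) measurable_from_top.aemeasurable
    (Filter.Eventually.of_forall fun ω => ⟨ha₀ ω, by linarith [le_abs_self (g ω - g a₀), hc ω a₀]⟩)
  have h1 := key.mgf_le 1
  simp only [ProbabilityTheory.mgf, hint, one_mul, Real.exp_sub, div_eq_inv_mul,
    expect_mul_left] at h1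
  rw [inv_mul_le_iff₀ (Real.exp_pos _), ← Real.exp_add] at h1
  refine h1.trans (Real.exp_le_exp.mpr (le_of_eq ?_))
  simp [abs_of_nonneg hc0]
  ring

end Expect

/-- The exponential-moment form of **McDiarmid's inequality** for i.i.d. samples. -/
lemma expect_exp_le_of_bounded_differences {α : Type*} [Fintype α] {p : α → ℝ}
    (hp : ∀ a, 0 ≤ p a) (hp1 : ∑ a, p a = 1) {n : ℕ} {c : ℝ} (f : (Fin n → α) → ℝ)
    (hf : ∀ s t b, |f (Function.update s t b) - f s| ≤ c) :
    expect (prodP p) (fun ω => Real.exp (f ω)) ≤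
      Real.exp (expect (prodP p) f + n * (c ^ 2 / 8)) := by
  induction n with
  | zero => simp [expect, prodP]
  | succ n ih =>
    rw [expect_prodP_succ, expect_prodP_succ]
    have hcons : ∀ a b (ω : Fin n → α),
        |f (Fin.cons a ω) - f (Fin.cons b ω)| ≤ c := fun a b ω => by
      simpa using hf (Fin.cons b ω) 0 a
    calc _ ≤ expect p fun a => Real.exp (n * (c ^ 2 / 8)) *
          Real.exp (expect (prodP p) fun ω : Fin n → α => f (Fin.cons a ω)) := by
          refine expect_mono hp fun a => ?_
          rw [← Real.exp_add, add_comm ((n : ℝ) * _)]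
          refine ih (fun ω => f (Fin.cons a ω)) fun s t b => ?_
          rw [Fin.cons_update]
          exact hf _ _ _
      _ ≤ Real.exp (n * (c ^ 2 / 8)) * Real.exp (_ + c ^ 2 / 8) := by
          rw [expect_mul_left]
          refine mul_le_mul_of_nonneg_left
            (expect_exp_le_of_abs_sub_le hp hp1 fun a b => ?_) (Real.exp_nonneg _)
          rw [← expect_sub, abs_le]
          constructor
          · rw [← expect_const (sum_prodP (n := n) hp1) (-c)]
            exact expect_mono (prodP_nonneg hp) fun ω => (abs_le.mp (hcons a b ω)).1
          · rw [← expect_const (sum_prodP (n := n) hp1) c]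
            exact expect_mono (prodP_nonneg hp) fun ω => (abs_le.mp (hcons a b ω)).2
      _ = _ := by
          rw [← Real.exp_add]
          push_cast
          ring_nf

/-- **McDiarmid's inequality** for i.i.d. samples from a pmf on a finite type. -/
lemma probEvent_ge_le_of_bounded_differences {α : Type*} [Fintype α] {p : α → ℝ}
    (hp : ∀ a, 0 ≤ p a) (hp1 : ∑ a, p a = 1) {n : ℕ} (hn : 0 < n) {c ε : ℝ} (hc : 0 < c)
    (hε : 0 ≤ ε) (f : (Fin n → α) → ℝ)
    (hf : ∀ s t b, |f (Function.update s t b) - f s| ≤ c) :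
    probEvent (prodP p) (fun ω => expect (prodP p) f + ε ≤ f ω) ≤
      Real.exp (-(2 * ε ^ 2) / (n * c ^ 2)) := by
  have hn' : (0 : ℝ) < n := by exact_mod_cast hn
  set μ := expect (prodP p) f with hμ
  set l : ℝ := 4 * ε / (n * c ^ 2) with hl
  have hl0 : 0 ≤ l := by positivity
  calc _ ≤ expect (prodP p) fun ω => Real.exp (-(l * (μ + ε))) * Real.exp (l * f ω) := by
        refine Finset.sum_le_sum fun ω _ => ?_
        have h0 := prodP_nonneg hp ω
        split_ifs with h
        · beta_reduce at h ⊢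
          rw [← Real.exp_add]
          exact le_mul_of_one_le_right h0 (Real.one_le_exp (by nlinarith))
        · positivity
    _ ≤ Real.exp (-(l * (μ + ε))) * Real.exp (l * μ + n * ((l * c) ^ 2 / 8)) := by
        rw [expect_mul_left, hμ, ← expect_mul_left l f]
        refine mul_le_mul_of_nonneg_left (expect_exp_le_of_bounded_differences hp hp1 _
          fun s t b => ?_) (Real.exp_nonneg _)
        rw [← mul_sub, abs_mul, abs_of_nonneg hl0]
        exact mul_le_mul_of_nonneg_left (hf s t b) hl0
    _ = _ := by
        rw [← Real.exp_add, hl]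
        congr 1
        field_simp
        ring

lemma expect_prodP_sum {α : Type*} [Fintype α] {p : α → ℝ} (hp1 : ∑ a, p a = 1) (n : ℕ)
    (h : α → ℝ) :
    expect (prodP p) (fun ω : Fin n → α => ∑ t, h (ω t)) = n * expect p h := by
  induction n with
  | zero => simp [expect]
  | succ n ih =>
    simp only [expect_prodP_succ, Fin.sum_univ_succ, Fin.cons_zero, Fin.cons_succ, expect_add,
      expect_const (sum_prodP hp1), ih, expect_const hp1]
    push_cast
    ring

lemma expect_prodP_sum_sq {α : Type*} [Fintype α] {p : α → ℝ} (hp1 : ∑ a, p a = 1) (n : ℕ)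
    (h : α → ℝ) :
    expect (prodP p) (fun ω : Fin n → α => (∑ t, h (ω t)) ^ 2) =
      n * expect p (fun a => h a ^ 2) + n * (n - 1) * expect p h ^ 2 := by
  induction n with
  | zero => simp [expect]
  | succ n ih =>
    have h2 : ∀ c : ℝ, expect p (fun a => 2 * h a * c) = 2 * c * expect p h := fun c => by
      rw [← expect_mul_left]; congr 1; ext a; ring
    simp only [expect_prodP_succ, Fin.sum_univ_succ, Fin.cons_zero, Fin.cons_succ, add_sq,
      expect_add, expect_const (sum_prodP hp1), ih, expect_const hp1, expect_mul_left,
      expect_prodP_sum hp1, h2]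
    push_cast
    ring

/-! ### Bounded differences of the empirical entropy -/

lemma mul_log_succ_sub_mem_Icc (k : ℕ) :
    ((k : ℝ) + 1) * Real.log (k + 1) - k * Real.log k ∈ Set.Icc 0 (2 * Real.log (k + 1)) := by
  rcases Nat.eq_zero_or_pos k with rfl | hk
  · simp
  have hk' : (0 : ℝ) < k := by exact_mod_cast hk
  have hdiff : Real.log (k + 1) - Real.log k = Real.log (1 + 1 / k) := by
    rw [← Real.log_div (by positivity) (by positivity)]
    congr 1
    field_simp
  have h1 : 0 ≤ Real.log (1 + 1 / (k : ℝ)) := Real.log_nonneg (by simp)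
  have h2 : (k : ℝ) * Real.log (1 + 1 / k) ≤ Real.log (k + 1) := by
    rcases Nat.lt_or_ge k 2 with hk2 | hk2
    · obtain rfl : k = 1 := by omega
      norm_num
    · have hk3 : (2 : ℝ) ≤ k := by exact_mod_cast hk2
      have h3 : Real.log (1 + 1 / (k : ℝ)) ≤ 1 / k := by
        have := Real.log_le_sub_one_of_pos (show 0 < 1 + 1 / (k : ℝ) by positivity)
        linarith
      calc (k : ℝ) * Real.log (1 + 1 / k) ≤ k * (1 / k) := by gcongr
        _ = 1 := by field_simp
        _ ≤ Real.log (k + 1) := by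
          rw [Real.le_log_iff_exp_le (by positivity)]
          linarith [Real.exp_one_lt_d9]
  have hl : 0 ≤ Real.log ((k : ℝ) + 1) := Real.log_nonneg (by linarith)
  constructor <;> nlinarith

lemma abs_ent_empDist_update_sub_le {α : Type*} [Fintype α] {n : ℕ} (s : Fin n → α) (t : Fin n)
    (b : α) :
    |ent (empDist (Function.update s t b)) - ent (empDist s)| ≤ 2 * Real.logb 2 n / n := by
  have hn : 0 < n := t.pos
  have hn' : (0 : ℝ) < n := by exact_mod_cast hn
  set r : α → ℕ := fun x => ((Finset.univ.erase t).filter fun u => s u = x).card with hr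
  set F : ℕ → ℝ := fun k => ((k : ℝ) / n) * Real.logb 2 ((k : ℝ) / n) with hF
  have hcount : ∀ a x, ((Finset.univ.filter fun u => Function.update s t a u = x).card : ℕ)
      = if x = a then r x + 1 else r x := by
    intro a x
    rw [← Finset.insert_erase (Finset.mem_univ t), Finset.filter_insert,
      Finset.filter_congr (q := fun u => s u = x) (s := Finset.univ.erase t)]
    · simp only [Function.update_self, eq_comm (a := a)]
      split_ifs
      · rw [Finset.card_insert_of_notMem (by simp)]
      · rfl
    · intro u hu
      rw [Function.update_of_ne (Finset.ne_of_mem_erase hu)]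
  have hent : ∀ a, ent (empDist (Function.update s t a)) =
      -(∑ x, F (r x)) - (F (r a + 1) - F (r a)) := by
    intro a
    have : ∑ x, (F (if x = a then r x + 1 else r x) - F (r x)) = F (r a + 1) - F (r a) := by
      rw [Finset.sum_eq_single a] <;> simp +contextual
    rw [Finset.sum_sub_distrib] at this
    simp only [EMI.ent, empDist, hcount]
    linarith
  have hrlt : ∀ a, r a + 1 ≤ n := fun a => by
    have : r a ≤ _ := Finset.card_filter_le (Finset.univ.erase t) fun u => s u = a
    rw [Finset.card_erase_of_mem (Finset.mem_univ t), Finset.card_univ, Fintype.card_fin] at this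
    omega
  have hlog2 : 0 < Real.log 2 := Real.log_pos one_lt_two
  have hFmul : ∀ k : ℕ, n * Real.log 2 * F k = k * Real.log k - k * Real.log n := fun k => by
    rcases Nat.eq_zero_or_pos k with rfl | hk
    · simp [hF]
    · have hk' : (k : ℝ) ≠ 0 := by exact_mod_cast hk.ne'
      simp only [hF, Real.logb, Real.log_div hk' hn'.ne']
      field_simp
  have hD : ∀ a, n * Real.log 2 * (F (r a + 1) - F (r a)) + Real.log n ∈
      Set.Icc 0 (2 * Real.log n) := fun a => by
    have h := mul_log_succ_sub_mem_Icc (r a)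
    have hle : Real.log ((r a : ℝ) + 1) ≤ Real.log n :=
      Real.log_le_log (by positivity) (by exact_mod_cast hrlt a)
    rw [mul_sub, hFmul, hFmul]
    push_cast
    constructor <;> linarith [h.1, h.2]
  have h0 := hent (s t)
  rw [Function.update_eq_self] at h0
  have hs : |n * Real.log 2 * (ent (empDist (Function.update s t b)) - ent (empDist s))| ≤
      2 * Real.log n := by
    rw [hent, h0, abs_le]
    have h1 := hD b
    have h2 := hD (s t)
    constructor <;> nlinarith [h1.1, h1.2, h2.1, h2.2]
  rw [abs_mul, abs_of_pos (by positivity)] at hs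
  rw [Real.logb, le_div_iff₀ hn', mul_div_assoc', le_div_iff₀ hlog2]
  linarith

lemma abs_emi_update_sub_le {α β : Type*} [Fintype α] [Fintype β] {n : ℕ} (s : Fin n → α × β)
    (t : Fin n) (b : α × β) :
    |emi (Function.update s t b) - emi s| ≤ 6 * Real.logb 2 n / n := by
  have hfst : (fun u => (Function.update s t b u).1) = Function.update (fun u => (s u).1) t b.1 :=
    Function.comp_update Prod.fst s t b
  have hsnd : (fun u => (Function.update s t b u).2) = Function.update (fun u => (s u).2) t b.2 :=
    Function.comp_update Prod.snd s t b
  have h1 := abs_le.mp (abs_ent_empDist_update_sub_le (fun u => (s u).1) t b.1)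
  have h2 := abs_le.mp (abs_ent_empDist_update_sub_le (fun u => (s u).2) t b.2)
  have h3 := abs_le.mp (abs_ent_empDist_update_sub_le s t b)
  have h6 : 6 * Real.logb 2 n / n = 3 * (2 * Real.logb 2 n / n) := by ring
  rw [emi, emi, hfst, hsnd, abs_le, h6]
  constructor <;> linarith [h1.1, h1.2, h2.1, h2.2, h3.1, h3.2]

/-! ### Bias of the empirical entropy -/

lemma empDist_comp_eq_sum {α β : Type*} [Fintype β] {n : ℕ} (φ : α → β) (s : Fin n → α)
    (b : β) :
    empDist (fun t => φ (s t)) b = (n : ℝ)⁻¹ * ∑ t, if φ (s t) = b then (1 : ℝ) else 0 := by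
  rw [empDist, Finset.sum_boole]
  ring

section Bias

variable {α β : Type*} [Fintype α] [Fintype β] {p : α → ℝ} {n : ℕ}

lemma expect_empDist (hp1 : ∑ a, p a = 1) (hn : 0 < n) (φ : α → β) (b : β) :
    expect (prodP p) (fun s : Fin n → α => empDist (fun t => φ (s t)) b) =
      ∑ a, if φ a = b then p a else 0 := by
  have hn' : (n : ℝ) ≠ 0 := by exact_mod_cast hn.ne'
  simp only [empDist_comp_eq_sum]
  rw [expect_mul_left, expect_prodP_sum hp1 n fun a => if φ a = b then (1 : ℝ) else 0,
    inv_mul_cancel_left₀ hn']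
  simp [expect]

lemma expect_empDist_sq (hp1 : ∑ a, p a = 1) (hn : 0 < n) (φ : α → β) (b : β) :
    expect (prodP p) (fun s : Fin n → α => empDist (fun t => φ (s t)) b ^ 2) =
      (n : ℝ)⁻¹ * (∑ a, if φ a = b then p a else 0) +
        (1 - (n : ℝ)⁻¹) * (∑ a, if φ a = b then p a else 0) ^ 2 := by
  have hn' : (n : ℝ) ≠ 0 := by exact_mod_cast hn.ne'
  simp only [empDist_comp_eq_sum, mul_pow]
  rw [expect_mul_left, expect_prodP_sum_sq hp1 n fun a => if φ a = b then (1 : ℝ) else 0]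
  simp only [expect, ite_pow, one_pow, zero_pow two_ne_zero, mul_ite, mul_one, mul_zero]
  field_simp

/-- The plug-in entropy estimator is biased downwards, by at most `log (1 + (|β| - 1) / n)`. -/
lemma ent_sub_expect_ent_empDist_mem_Icc (hp : ∀ a, 0 ≤ p a) (hp1 : ∑ a, p a = 1) (hn : 0 < n)
    (φ : α → β) {P : β → ℝ} (hP : ∀ b, P b = ∑ a, if φ a = b then p a else 0)
    (hpos : ∀ b, 0 < P b) :
    ent P - expect (prodP p) (fun s : Fin n → α => ent (empDist fun t => φ (s t))) ∈
      Set.Icc 0 (Real.logb 2 (1 + ((Fintype.card β : ℝ) - 1) / n)) := by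
  have hn' : (0 : ℝ) < n := by exact_mod_cast hn
  have hlog2 : 0 < Real.log 2 := Real.log_pos one_lt_two
  have hPsum : ∑ b, P b = 1 := by
    simp only [hP]
    rw [Finset.sum_comm]
    simpa using hp1
  have hcard : (1 : ℝ) ≤ Fintype.card β := by
    have : Nonempty β := by
      by_contra h
      simp [not_nonempty_iff.mp h] at hPsum
    exact_mod_cast Fintype.card_pos (α := β)
  set T : ℝ := 1 + ((Fintype.card β : ℝ) - 1) / n with hT
  have hTpos : 0 < T := by
    have : 0 ≤ ((Fintype.card β : ℝ) - 1) / n := div_nonneg (by linarith) hn'.le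
    linarith
  set Q : (Fin n → α) → β → ℝ := fun s => empDist fun t => φ (s t) with hQ
  have hQ0 : ∀ s b, 0 ≤ Q s b := fun s b => by
    simp only [hQ, empDist]
    positivity
  have hEQ : ∀ b, expect (prodP p) (fun s => Q s b) = P b := fun b => by
    rw [hP]; exact expect_empDist hp1 hn φ b
  have hEQ2 : ∀ b, expect (prodP p) (fun s => Q s b ^ 2) =
      (n : ℝ)⁻¹ * P b + (1 - (n : ℝ)⁻¹) * P b ^ 2 := fun b => by
    rw [hP]; exact expect_empDist_sq hp1 hn φ b
  have hkey : Real.log 2 * (ent P - expect (prodP p) fun s => ent (Q s)) =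
      expect (prodP p) fun s => ∑ b, Q s b * (Real.log (Q s b) - Real.log (P b)) := by
    simp only [expect_sum, mul_sub, expect_sub]
    simp only [mul_comm (Q _ _) (Real.log (P _)), expect_mul_left, hEQ]
    have hent : ∀ q : β → ℝ, ent q = -(Real.log 2)⁻¹ * ∑ b, q b * Real.log (q b) := fun q => by
      simp only [EMI.ent, Real.logb, Finset.mul_sum, ← Finset.sum_neg_distrib]
      exact Finset.sum_congr rfl fun b _ => by ring
    simp only [hent, expect_mul_left, expect_sum, Finset.sum_sub_distrib, mul_comm (P _)]
    field_simp
    ring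
  have hlow : 0 ≤ expect (prodP p) fun s => ∑ b, Q s b * (Real.log (Q s b) - Real.log (P b)) := by
    calc (0 : ℝ) = expect (prodP p) fun s => ∑ b, (Q s b - P b) := by
          simp [expect_sum, expect_sub, hEQ, expect_const (sum_prodP hp1)]
      _ ≤ _ := by
          refine expect_mono (prodP_nonneg hp) fun s => Finset.sum_le_sum fun b _ => ?_
          rcases (hQ0 s b).eq_or_lt with h | h
          · simp [← h, (hpos b).le]
          · have h1 := Real.log_le_sub_one_of_pos (div_pos (hpos b) h)
            rw [Real.log_div (hpos b).ne' h.ne'] at h1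
            have h2 := mul_le_mul_of_nonneg_left h1 h.le
            have h3 : Q s b * (P b / Q s b - 1) = P b - Q s b := by field_simp
            linarith
  have hupp : (expect (prodP p) fun s => ∑ b, Q s b * (Real.log (Q s b) - Real.log (P b))) ≤
      Real.log T := by
    calc _ ≤ expect (prodP p) fun s => ∑ b, ((Real.log T - 1) * Q s b +
            (P b * T)⁻¹ * Q s b ^ 2) := by
          refine expect_mono (prodP_nonneg hp) fun s => Finset.sum_le_sum fun b _ => ?_
          rcases (hQ0 s b).eq_or_lt with h | h
          · simp [← h]
          · have hPT := mul_pos (hpos b) hTpos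
            have h1 := Real.log_le_sub_one_of_pos (div_pos h hPT)
            rw [Real.log_div h.ne' hPT.ne', Real.log_mul (hpos b).ne' hTpos.ne'] at h1
            have h2 := mul_le_mul_of_nonneg_left h1 h.le
            have h3 : Q s b * (Q s b / (P b * T) - 1) = (P b * T)⁻¹ * Q s b ^ 2 - Q s b := by
              ring
            linarith
      _ = (Real.log T - 1) + T⁻¹ * ∑ b, ((n : ℝ)⁻¹ + (1 - (n : ℝ)⁻¹) * P b) := by
          simp only [expect_sum, expect_add, expect_mul_left, hEQ, hEQ2, Finset.sum_add_distrib,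
            ← Finset.mul_sum, hPsum, mul_one]
          congr 1
          have (b : β) : (P b * T)⁻¹ * ((n : ℝ)⁻¹ * P b + (1 - (n : ℝ)⁻¹) * P b ^ 2) =
              T⁻¹ * ((n : ℝ)⁻¹ + (1 - (n : ℝ)⁻¹) * P b) := by
            have := (hpos b).ne'
            field_simp
          simp only [this, ← Finset.mul_sum, Finset.sum_add_distrib, hPsum, mul_one]
      _ = Real.log T := by
          rw [Finset.sum_add_distrib, ← Finset.mul_sum, hPsum]
          have : ∑ _b : β, (n : ℝ)⁻¹ + (1 - (n : ℝ)⁻¹) * 1 = T := by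
            simp [hT]
            ring
          rw [this, inv_mul_cancel₀ hTpos.ne']
          ring
  rw [← hkey] at hlow hupp
  refine ⟨nonneg_of_mul_nonneg_right hlow hlog2, ?_⟩
  rw [Real.logb, le_div_iff₀ hlog2]
  linarith

end Bias

lemma expect_emi_sub_miDist_mem_Icc {α β : Type*} [Fintype α] [Fintype β] {p : α × β → ℝ} {n : ℕ}
    (hp : ∀ a, 0 < p a) (hp1 : ∑ a, p a = 1) (hn : 0 < n) :
    expect (prodP p) (fun s : Fin n → α × β => emi s) - miDist p ∈ Set.Icc
      (-(Real.logb 2 (1 + ((Fintype.card α : ℝ) - 1) / n) +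
        Real.logb 2 (1 + ((Fintype.card β : ℝ) - 1) / n)))
      (Real.logb 2 (1 + ((Fintype.card α : ℝ) * Fintype.card β - 1) / n)) := by
  have : Nonempty (α × β) := by
    by_contra h
    simp [not_nonempty_iff.mp h] at hp1
  obtain ⟨hα, hβ⟩ := nonempty_prod.mp this
  have hp' := fun a => (hp a).le
  have h1 := ent_sub_expect_ent_empDist_mem_Icc hp' hp1 hn Prod.fst
    (P := fun a => ∑ b, p (a, b))
    (fun a => by
      rw [Fintype.sum_prod_type, Finset.sum_eq_single a] <;> simp +contextual)
    (fun a => Finset.sum_pos (fun _ _ => hp _) Finset.univ_nonempty)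
  have h2 := ent_sub_expect_ent_empDist_mem_Icc hp' hp1 hn Prod.snd
    (P := fun b => ∑ a, p (a, b))
    (fun b => by
      rw [Fintype.sum_prod_type_right, Finset.sum_eq_single b] <;> simp +contextual)
    (fun b => Finset.sum_pos (fun _ _ => hp _) Finset.univ_nonempty)
  have h3 := ent_sub_expect_ent_empDist_mem_Icc hp' hp1 hn id (P := p)
    (fun a => by rw [Finset.sum_eq_single a] <;> simp +contextual) hp
  simp only [emi, miDist, expect_sub, expect_add]
  simp only [id, Fintype.card_prod, Nat.cast_mul] at h3
  constructor <;> linarith [h1.1, h1.2, h2.1, h2.2, h3.1, h3.2]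

section ProbEvent

variable {Ω : Type*} [Fintype Ω] {P : Ω → ℝ}

lemma probEvent_mono (hP : ∀ ω, 0 ≤ P ω) {s t : Ω → Prop} (h : ∀ ω, s ω → t ω) :
    probEvent P s ≤ probEvent P t := by
  refine Finset.sum_le_sum fun ω _ => ?_
  by_cases hs : s ω
  · simp [hs, h ω hs]
  · rw [if_neg hs]
    split_ifs
    exacts [hP ω, le_rfl]

lemma probEvent_exists_le (hP : ∀ ω, 0 ≤ P ω) {ι : Type*} [Fintype ι] (s : ι → Ω → Prop) :
    probEvent P (fun ω => ∃ i, s i ω) ≤ ∑ i, probEvent P (s i) := by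
  simp only [probEvent]
  rw [Finset.sum_comm]
  refine Finset.sum_le_sum fun ω _ => ?_
  have h0 : ∀ i ∈ Finset.univ, 0 ≤ if s i ω then P ω else 0 := fun i _ => by
    split_ifs
    exacts [hP ω, le_rfl]
  split_ifs with h
  · obtain ⟨i, hi⟩ := h
    simpa [hi] using Finset.single_le_sum h0 (Finset.mem_univ i)
  · exact Finset.sum_nonneg h0

lemma probEvent_le_one (hP : ∀ ω, 0 ≤ P ω) (hP1 : ∑ ω, P ω = 1) (s : Ω → Prop) :
    probEvent P s ≤ 1 :=
  (probEvent_mono hP (t := fun _ => True) fun _ _ => trivial).trans (by simp [probEvent, hP1])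

/-- The marginal of a product pmf. -/
lemma probEvent_pi_eval {ι : Type*} [Fintype ι] [DecidableEq ι] {P : ι → Ω → ℝ}
    (hP1 : ∀ i, ∑ ω, P i ω = 1) (i : ι) (s : Ω → Prop) :
    probEvent (fun ω : ι → Ω => ∏ j, P j (ω j)) (fun ω => s (ω i)) = probEvent (P i) s := by
  have h : ∀ ω : ι → Ω, (if s (ω i) then ∏ j, P j (ω j) else 0) =
      ∏ j, if j = i then (if s (ω j) then P j (ω j) else 0) else P j (ω j) := by
    intro ω
    rw [← Finset.mul_prod_erase _ _ (Finset.mem_univ i),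
      ← Finset.mul_prod_erase (a := i) _ _ (Finset.mem_univ i), if_pos rfl, ite_mul, zero_mul]
    congr 2
    exact Finset.prod_congr rfl fun j hj => by rw [if_neg (Finset.ne_of_mem_erase hj)]
  simp only [probEvent, h]
  rw [← Fintype.prod_sum fun j ω => if j = i then (if s ω then P j ω else 0) else P j ω,
    Finset.prod_eq_single i]
  · simp
  · intro j _ hj
    simp [hj, hP1]
  · simp

end ProbEvent

/-- One-sided concentration of the empirical mutual information around its mean, in both
directions. -/
lemma probEvent_emi_deviation_le {α β : Type*} [Fintype α] [Fintype β] {p : α × β → ℝ}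
    (hp : ∀ a, 0 ≤ p a) (hp1 : ∑ a, p a = 1) {n : ℕ} (hn : 2 ≤ n) {ε : ℝ} (hε : 0 ≤ ε) :
    probEvent (prodP p) (fun s : Fin n → α × β => expect (prodP (n := n) p) emi + ε ≤ emi s) ≤
        Real.exp (-(n * ε ^ 2) / (18 * Real.logb 2 n ^ 2)) ∧
      probEvent (prodP p) (fun s : Fin n → α × β => emi s ≤ expect (prodP (n := n) p) emi - ε) ≤
        Real.exp (-(n * ε ^ 2) / (18 * Real.logb 2 n ^ 2)) := by
  have hn' : (0 : ℝ) < n := by exact_mod_cast (by omega : 0 < n)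
  have hL : 0 < Real.logb 2 n := Real.logb_pos one_lt_two (by exact_mod_cast hn)
  have hc : 0 < 6 * Real.logb 2 n / n := by positivity
  have hexp : -(2 * ε ^ 2) / (n * (6 * Real.logb 2 n / n) ^ 2) =
      -(n * ε ^ 2) / (18 * Real.logb 2 n ^ 2) := by
    field_simp
    ring
  rw [← hexp]
  constructor
  · exact probEvent_ge_le_of_bounded_differences hp hp1 (by omega) hc hε emi abs_emi_update_sub_le
  · refine (probEvent_mono (prodP_nonneg hp) fun s hs => ?_).trans
      (probEvent_ge_le_of_bounded_differences hp hp1 (by omega) hc hε (fun s => -1 * emi s)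
        fun s t b => ?_)
    · rw [expect_mul_left]
      linarith
    · rw [← mul_sub, abs_mul]
      simpa using abs_emi_update_sub_le s t b

lemma sum_pairP {m : ℕ} {𝒳 : Type*} [Fintype 𝒳] (p : (Fin m → 𝒳) → ℝ) (i j : Fin m) :
    ∑ ab, pairP p i j ab = ∑ x, p x := by
  simp only [pairP]
  rw [Finset.sum_comm]
  refine Finset.sum_congr rfl fun x _ => ?_
  rw [Finset.sum_eq_single (x i, x j)]
  · simp
  · rintro ⟨a, b⟩ _ h
    refine if_neg fun h' => h ?_
    rw [h'.1, h'.2]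
  · simp

lemma logb_one_add_div_lt {x y d : ℝ} (hx : 0 ≤ x) (hy : 0 < y) (hd : 0 < d)
    (h : x / ((2 : ℝ) ^ d - 1) < y) : Real.logb 2 (1 + x / y) < d := by
  have h1 : 0 < (2 : ℝ) ^ d - 1 := sub_pos.mpr (Real.one_lt_rpow one_lt_two hd)
  have h2 : 0 ≤ x / y := div_nonneg hx hy.le
  rw [Real.logb_lt_iff_lt_rpow one_lt_two (by linarith)]
  rw [div_lt_comm₀ h1 hy] at h
  linarith

/-- Uniform-sampling bandit identification of the minimizing edge of an
MCT: the probability that the empirical-MI argmin `est` differs from the unique minimizing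
edge (ī,j̄) is at most 2|E|·exp(−(N/|E|)Δ₁²/(648·log²(N/|E|))), for all
N > |E|·max{(|𝒳|²−1)/(2^{Δ₁/3}−1), (|𝒳|−1)/(2^{Δ₁/6}−1)}. -/
theorem bandit_edge_identification_error
    {m : ℕ} (hm : 2 ≤ m) (𝒳 : Type) [Fintype 𝒳]
    (p : (Fin m → 𝒳) → ℝ) (hp0 : ∀ x, 0 ≤ p x) (hp1 : ∑ x, p x = 1)
    (G : SimpleGraph (Fin m)) (hG : G.IsTree)
    (hMCT : MCT.IsMCT (fun _ => 𝒳) G p)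
    (E : Finset (Fin m × Fin m))
    (hEadj : ∀ i j : Fin m, G.Adj i j ↔ ((i, j) ∈ E ∨ (j, i) ∈ E))
    (hEonce : ∀ e ∈ E, (e.2, e.1) ∉ E)
    (hfull : ∀ e ∈ E, ∀ ab : 𝒳 × 𝒳, 0 < pairP p e.1 e.2 ab)
    (ebar : Fin m × Fin m) (hebar : ebar ∈ E)
    (hmin : ∀ e ∈ E, e ≠ ebar →
      EMI.miDist (pairP p ebar.1 ebar.2) < EMI.miDist (pairP p e.1 e.2))
    (Δ₁ : ℝ) (hΔ₁pos : 0 < Δ₁)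
    (hΔ₁ : Δ₁ = sInf {r | ∃ e ∈ E, e ≠ ebar ∧
      r = EMI.miDist (pairP p e.1 e.2) - EMI.miDist (pairP p ebar.1 ebar.2)})
    (n N : ℕ) (hNn : N = E.card * n)
    (est : ((e : {x // x ∈ E}) → Fin n → 𝒳 × 𝒳) → Fin m × Fin m)
    (hestmem : ∀ ω : (e : {x // x ∈ E}) → Fin n → 𝒳 × 𝒳, est ω ∈ E)
    (hestmin : ∀ (ω : (e : {x // x ∈ E}) → Fin n → 𝒳 × 𝒳) (e : {x // x ∈ E}),
      EMI.emi (ω ⟨est ω, hestmem ω⟩) ≤ EMI.emi (ω e))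
    (hNbig : (N : ℝ) > E.card * max
        (((Fintype.card 𝒳 : ℝ) ^ 2 - 1) / ((2 : ℝ) ^ (Δ₁ / 3) - 1))
        (((Fintype.card 𝒳 : ℝ) - 1) / ((2 : ℝ) ^ (Δ₁ / 6) - 1))) :
    EMI.probEvent
        (fun ω : (e : {x // x ∈ E}) → Fin n → 𝒳 × 𝒳 =>
          ∏ e : {x // x ∈ E}, EMI.prodP (pairP p e.1.1 e.1.2) (ω e))
        (fun ω => est ω ≠ ebar)
      ≤ 2 * E.card * Real.exp (-(((N : ℝ) / E.card) * Δ₁ ^ 2)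
          / (648 * Real.logb 2 ((N : ℝ) / E.card) ^ 2)) := by
  have hcardE : (0 : ℝ) < E.card := by exact_mod_cast Finset.card_pos.mpr ⟨ebar, hebar⟩
  have hNdiv : (N : ℝ) / E.card = n := by
    rw [hNn]
    push_cast
    field_simp
  rw [hNdiv]
  have hne : Nonempty 𝒳 := by
    by_contra h
    have : IsEmpty (Fin m → 𝒳) := ⟨fun x => h ⟨x ⟨0, by omega⟩⟩⟩
    simp at hp1
  have hcardX : (1 : ℝ) ≤ Fintype.card 𝒳 := by exact_mod_cast Fintype.card_pos (α := 𝒳)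
  rw [gt_iff_lt, mul_comm, ← lt_div_iff₀ hcardE, hNdiv, max_lt_iff] at hNbig
  obtain ⟨hbig₁, hbig₂⟩ := hNbig
  have hden : 0 < (2 : ℝ) ^ (Δ₁ / 6) - 1 :=
    sub_pos.mpr (Real.one_lt_rpow one_lt_two (by positivity))
  have hn' : (0 : ℝ) < n := (div_nonneg (by linarith) hden.le).trans_lt hbig₂
  have hn : 0 < n := by exact_mod_cast hn'
  have hb₁ := logb_one_add_div_lt (by nlinarith) hn' (by positivity) hbig₁
  have hb₂ := logb_one_add_div_lt (by linarith) hn' (by positivity) hbig₂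
  have hgap : ∀ e ∈ E, e ≠ ebar →
      Δ₁ ≤ EMI.miDist (pairP p e.1 e.2) - EMI.miDist (pairP p ebar.1 ebar.2) := by
    intro e he hne
    rw [hΔ₁]
    refine csInf_le ⟨0, ?_⟩ ⟨e, he, hne, rfl⟩
    rintro _ ⟨e', he', hne', rfl⟩
    exact (sub_pos.mpr (hmin e' he' hne')).le
  set P : {x // x ∈ E} → 𝒳 × 𝒳 → ℝ := fun e => pairP p e.1.1 e.1.2 with hPdef
  have hP : ∀ e a, 0 < P e a := fun e a => hfull e.1 e.2 a
  have hP' : ∀ e a, 0 ≤ P e a := fun e a => (hP e a).le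
  have hP1 : ∀ e, ∑ a, P e a = 1 := fun e => (sum_pairP p _ _).trans hp1
  have hprod0 : ∀ ω : (e : {x // x ∈ E}) → Fin n → 𝒳 × 𝒳, 0 ≤ ∏ e, prodP (P e) (ω e) :=
    fun ω => Finset.prod_nonneg fun e _ => prodP_nonneg (hP' e) _
  have hprod1 : ∑ ω : (e : {x // x ∈ E}) → Fin n → 𝒳 × 𝒳, ∏ e, prodP (P e) (ω e) = 1 := by
    rw [← Fintype.prod_sum fun e ω => prodP (P e) ω]
    simp [sum_prodP, hP1]
  have hcardE1 : (1 : ℝ) ≤ E.card := by exact_mod_cast Finset.card_pos.mpr ⟨ebar, hebar⟩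
  rcases Nat.lt_or_ge n 2 with hn2 | hn2
  · obtain rfl : n = 1 := by omega
    refine (probEvent_le_one hprod0 hprod1 _).trans ?_
    simp only [Nat.cast_one, Real.logb_one, ne_eq, OfNat.ofNat_ne_zero, not_false_eq_true,
      zero_pow, mul_zero, div_zero, Real.exp_zero]
    linarith
  have hbias : ∀ e : {x // x ∈ E},
      |expect (prodP (P e)) (fun s : Fin n → 𝒳 × 𝒳 => emi s) - miDist (P e)| ≤ Δ₁ / 3 := by
    intro e
    have h := expect_emi_sub_miDist_mem_Icc (hP e) (hP1 e) hn
    rw [← sq] at h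
    exact abs_le.mpr ⟨by linarith [h.1], by linarith [h.2]⟩
  let bad : {x // x ∈ E} → (Fin n → 𝒳 × 𝒳) → Prop := fun e s =>
    if e.1 = ebar then expect (prodP (n := n) (P e)) emi + Δ₁ / 6 ≤ emi s
    else emi s ≤ expect (prodP (n := n) (P e)) emi - Δ₁ / 6
  have hbad : ∀ e, probEvent (prodP (P e)) (bad e) ≤
      Real.exp (-(n * Δ₁ ^ 2) / (648 * Real.logb 2 n ^ 2)) := by
    intro e
    have hexp : -(n * Δ₁ ^ 2) / (648 * Real.logb 2 n ^ 2) =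
        -(n * (Δ₁ / 6) ^ 2) / (18 * Real.logb 2 n ^ 2) := by
      ring
    have h := probEvent_emi_deviation_le (hP' e) (hP1 e) hn2 (ε := Δ₁ / 6) (by positivity)
    rw [hexp]
    by_cases he : e.1 = ebar
    · simpa only [bad, if_pos he] using h.1
    · simpa only [bad, if_neg he] using h.2
  have hsub : ∀ ω : (e : {x // x ∈ E}) → Fin n → 𝒳 × 𝒳, est ω ≠ ebar → ∃ e, bad e (ω e) := by
    intro ω hω
    by_contra! hcon
    have h1 := hcon ⟨est ω, hestmem ω⟩
    have h2 := hcon ⟨ebar, hebar⟩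
    simp only [bad, if_neg hω, if_true, not_le] at h1 h2
    have h3 := (abs_le.mp (hbias ⟨est ω, hestmem ω⟩)).1
    have h4 := (abs_le.mp (hbias ⟨ebar, hebar⟩)).2
    have h5 := hgap _ (hestmem ω) hω
    have h6 := hestmin ω ⟨ebar, hebar⟩
    simp only [hPdef] at h1 h2 h3 h4
    linarith
  calc _ ≤ probEvent (fun ω : (e : {x // x ∈ E}) → Fin n → 𝒳 × 𝒳 => ∏ e, prodP (P e) (ω e))
        (fun ω => ∃ e, bad e (ω e)) := probEvent_mono hprod0 hsub
    _ ≤ ∑ e, probEvent (fun ω : (e : {x // x ∈ E}) → Fin n → 𝒳 × 𝒳 => ∏ e, prodP (P e) (ω e))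
        (fun ω => bad e (ω e)) := probEvent_exists_le hprod0 _
    _ ≤ ∑ _e : {x // x ∈ E}, Real.exp (-(n * Δ₁ ^ 2) / (648 * Real.logb 2 n ^ 2)) := by
        refine Finset.sum_le_sum fun e _ => ?_
        rw [probEvent_pi_eval (P := fun e => prodP (P e)) (fun e => sum_prodP (hP1 e)) e]
        exact hbad e
    _ ≤ _ := by
        rw [Finset.sum_const, Finset.card_univ, Fintype.card_coe, nsmul_eq_mul]
        gcongr
        linarith

end SIEst
end
end

section
/- Let X_1, …, X_m, m ≥ 2, be random variables with finite alphabets and joint pmf P_{X_M}. Then the total correlation and the dual total correlation satisfy the sandwich inequalities C(X_M)/(m−1) ≤ D(X_M) ≤ (m−1)·C(X_M). -/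
open Classical
open scoped BigOperators

noncomputable section

namespace MCT

variable {m : ℕ}

section Entropy

variable {𝒳 : Fin m → Type}

/-- Indicator that two outcomes agree on the coordinates in `A`. -/
def agree (A : Finset (Fin m)) (x y : ∀ i, 𝒳 i) : ℝ :=
  if ∀ i ∈ A, x i = y i then 1 else 0

lemma agree_of {A : Finset (Fin m)} {x y : ∀ i, 𝒳 i} (h : ∀ i ∈ A, x i = y i) :
    agree A x y = 1 :=
  if_pos h

lemma agree_of_not {A : Finset (Fin m)} {x y : ∀ i, 𝒳 i} (h : ¬ ∀ i ∈ A, x i = y i) :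
    agree A x y = 0 :=
  if_neg h

lemma agree_nonneg (A : Finset (Fin m)) (x y : ∀ i, 𝒳 i) : 0 ≤ agree A x y := by
  unfold agree
  split_ifs <;> norm_num

variable [∀ i, Fintype (𝒳 i)] {p : (∀ i, 𝒳 i) → ℝ}

/-- Probability of the event that an outcome agrees with `x` on `A`. -/
def cyl (p : (∀ i, 𝒳 i) → ℝ) (A : Finset (Fin m)) (x : ∀ i, 𝒳 i) : ℝ :=
  ∑ y, agree A y x * p y

lemma cyl_congr {A : Finset (Fin m)} {x y : ∀ i, 𝒳 i} (h : ∀ i ∈ A, x i = y i) :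
    cyl p A x = cyl p A y := by
  refine Finset.sum_congr rfl fun z _ => ?_
  have : (∀ i ∈ A, z i = x i) ↔ ∀ i ∈ A, z i = y i :=
    forall₂_congr fun i hi => by rw [h i hi]
  simp only [agree, this]

lemma cyl_nonneg (hp0 : ∀ x, 0 ≤ p x) (A : Finset (Fin m)) (x : ∀ i, 𝒳 i) : 0 ≤ cyl p A x :=
  Finset.sum_nonneg fun _ _ => mul_nonneg (agree_nonneg _ _ _) (hp0 _)

lemma le_cyl (hp0 : ∀ x, 0 ≤ p x) (A : Finset (Fin m)) (x : ∀ i, 𝒳 i) : p x ≤ cyl p A x := by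
  have h := Finset.single_le_sum (f := fun y => agree A y x * p y)
    (fun y _ => mul_nonneg (agree_nonneg A y x) (hp0 y)) (Finset.mem_univ x)
  simpa [agree_of, cyl] using h

lemma marg_restrict (A : Finset (Fin m)) (x : ∀ i, 𝒳 i) :
    marg 𝒳 p A (fun i => x i.1) = cyl p A x := by
  refine Finset.sum_congr rfl fun y _ => ?_
  simp [agree]

lemma ent_eq_sum (A : Finset (Fin m)) :
    ent 𝒳 p A = -∑ x, p x * Real.logb 2 (cyl p A x) := by
  have h (y : (i : A) → 𝒳 i.1) : marg 𝒳 p A y * Real.logb 2 (marg 𝒳 p A y) =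
      ∑ x : ∀ i, 𝒳 i, if y = (fun i : A => x i.1) then p x * Real.logb 2 (cyl p A x) else 0 := by
    conv_lhs => enter [1]; unfold marg
    rw [Finset.sum_mul]
    refine Finset.sum_congr rfl fun x _ => ?_
    by_cases hy : y = fun i : A => x i.1
    · subst hy
      simp [marg_restrict]
    · rw [if_neg hy, if_neg fun h => hy (funext fun i => (h i).symm), zero_mul]
  simp only [ent, h]
  rw [Finset.sum_comm]
  simp

lemma sum_agree_div_le (hp0 : ∀ x, 0 ≤ p x) (A B : Finset (Fin m)) (u v : ∀ i, 𝒳 i) :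
    ∑ x, agree A u x * agree B v x * (p x / (cyl p (A ∪ B) x * cyl p (A ∩ B) x)) ≤
      agree (A ∩ B) v u / cyl p (A ∩ B) u := by
  by_cases h : ∃ x : ∀ i, 𝒳 i, (∀ i ∈ A, u i = x i) ∧ ∀ i ∈ B, v i = x i
  · obtain ⟨w, hA, hB⟩ := h
    have huv : agree (A ∩ B) v u = 1 := agree_of fun i hi => by
      rw [Finset.mem_inter] at hi
      rw [hA i hi.1, hB i hi.2]
    calc
      _ = ∑ x, agree (A ∪ B) x w * p x / (cyl p (A ∪ B) w * cyl p (A ∩ B) u) := by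
        refine Finset.sum_congr rfl fun x _ => ?_
        by_cases hx : ∀ i ∈ A ∪ B, x i = w i
        · have hxA : ∀ i ∈ A, u i = x i := fun i hi => by
            rw [hA i hi, hx i (Finset.mem_union_left _ hi)]
          have hxB : ∀ i ∈ B, v i = x i := fun i hi => by
            rw [hB i hi, hx i (Finset.mem_union_right _ hi)]
          rw [agree_of hxA, agree_of hxB, agree_of hx, cyl_congr hx,
            cyl_congr (A := A ∩ B) fun i hi => (hxA i (Finset.mem_inter.1 hi).1).symm]
          ring
        · have : agree A u x * agree B v x = 0 := by
            by_contra hne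
            obtain ⟨h1, h2⟩ := mul_ne_zero_iff.1 hne
            have h1 := not_imp_comm.1 agree_of_not h1
            have h2 := not_imp_comm.1 agree_of_not h2
            refine hx fun i hi => ?_
            rcases Finset.mem_union.1 hi with hi | hi
            · rw [← h1 i hi, hA i hi]
            · rw [← h2 i hi, hB i hi]
          rw [this, agree_of_not hx]
          simp
      _ = cyl p (A ∪ B) w / cyl p (A ∪ B) w * (1 / cyl p (A ∩ B) u) := by
        rw [← Finset.sum_div, ← cyl, div_mul_div_comm, mul_one]
      _ ≤ 1 * (1 / cyl p (A ∩ B) u) :=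
        mul_le_mul_of_nonneg_right (div_self_le_one _)
          (one_div_nonneg.2 (cyl_nonneg hp0 _ _))
      _ = _ := by rw [huv, one_mul]
  · rw [Finset.sum_eq_zero]
    · exact div_nonneg (agree_nonneg _ _ _) (cyl_nonneg hp0 _ _)
    · intro x _
      by_cases hA : ∀ i ∈ A, u i = x i
      · rw [agree_of_not fun hB => h ⟨x, hA, hB⟩]
        simp
      · rw [agree_of_not hA]
        simp

lemma sum_mul_cyl_div_le (hp0 : ∀ x, 0 ≤ p x) (A B : Finset (Fin m)) :
    ∑ x, p x * (cyl p A x * cyl p B x / (cyl p (A ∪ B) x * cyl p (A ∩ B) x)) ≤ ∑ x, p x := by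
  calc
    _ = ∑ x, ∑ u, ∑ v, p u * p v *
          (agree A u x * agree B v x * (p x / (cyl p (A ∪ B) x * cyl p (A ∩ B) x))) := by
      refine Finset.sum_congr rfl fun x _ => ?_
      generalize cyl p (A ∪ B) x * cyl p (A ∩ B) x = c
      rw [cyl, cyl, Finset.sum_mul_sum, Finset.sum_div, Finset.mul_sum]
      refine Finset.sum_congr rfl fun u _ => ?_
      rw [Finset.sum_div, Finset.mul_sum]
      refine Finset.sum_congr rfl fun v _ => ?_
      ring
    _ = ∑ u, ∑ v, p u * p v *
          ∑ x, agree A u x * agree B v x * (p x / (cyl p (A ∪ B) x * cyl p (A ∩ B) x)) := by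
      rw [Finset.sum_comm]
      refine Finset.sum_congr rfl fun u _ => ?_
      rw [Finset.sum_comm]
      simp only [Finset.mul_sum]
    _ ≤ ∑ u, ∑ v, p u * p v * (agree (A ∩ B) v u / cyl p (A ∩ B) u) :=
      Finset.sum_le_sum fun u _ => Finset.sum_le_sum fun v _ =>
        mul_le_mul_of_nonneg_left (sum_agree_div_le hp0 A B u v) (mul_nonneg (hp0 u) (hp0 v))
    _ = ∑ u, p u * (cyl p (A ∩ B) u / cyl p (A ∩ B) u) := by
      refine Finset.sum_congr rfl fun u _ => ?_
      generalize hc : cyl p (A ∩ B) u = c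
      conv_rhs => enter [2, 1]; rw [← hc, cyl]
      rw [Finset.sum_div, Finset.mul_sum]
      refine Finset.sum_congr rfl fun v _ => ?_
      ring
    _ ≤ ∑ u, p u :=
      Finset.sum_le_sum fun u _ => mul_le_of_le_one_right (hp0 u) (div_self_le_one _)

theorem ent_submodular (hp0 : ∀ x, 0 ≤ p x) (A B : Finset (Fin m)) :
    ent 𝒳 p (A ∪ B) + ent 𝒳 p (A ∩ B) ≤ ent 𝒳 p A + ent 𝒳 p B := by
  have key : ∑ x, p x * (Real.log (cyl p A x) + Real.log (cyl p B x)
      - Real.log (cyl p (A ∪ B) x) - Real.log (cyl p (A ∩ B) x)) ≤ 0 := by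
    calc
      _ ≤ ∑ x, p x *
          (cyl p A x * cyl p B x / (cyl p (A ∪ B) x * cyl p (A ∩ B) x) - 1) := by
        refine Finset.sum_le_sum fun x _ => ?_
        rcases (hp0 x).eq_or_lt with hx | hx
        · simp [← hx]
        · have hpos (S : Finset (Fin m)) : 0 < cyl p S x := hx.trans_le (le_cyl hp0 S x)
          have hA := hpos A
          have hB := hpos B
          have hU := hpos (A ∪ B)
          have hI := hpos (A ∩ B)
          refine mul_le_mul_of_nonneg_left ?_ hx.le
          have hlog := Real.log_le_sub_one_of_pos (div_pos (mul_pos hA hB) (mul_pos hU hI))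
          rw [Real.log_div (mul_pos hA hB).ne' (mul_pos hU hI).ne',
            Real.log_mul hA.ne' hB.ne', Real.log_mul hU.ne' hI.ne'] at hlog
          linarith
      _ ≤ 0 := by
        simp only [mul_sub, mul_one, Finset.sum_sub_distrib]
        linarith [sum_mul_cyl_div_le hp0 A B]
  have h2 : 0 < Real.log 2 := Real.log_pos one_lt_two
  simp only [mul_sub, mul_add, Finset.sum_sub_distrib, Finset.sum_add_distrib] at key
  simp only [ent_eq_sum, Real.logb, ← mul_div_assoc, ← Finset.sum_div, ← neg_div, ← add_div]
  rw [div_le_div_iff_of_pos_right h2]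
  linarith

lemma ent_empty (hp1 : ∑ x, p x = 1) : ent 𝒳 p ∅ = 0 := by
  simp [ent_eq_sum, cyl, agree, hp1]

lemma ent_le_sum (hp0 : ∀ x, 0 ≤ p x) (hp1 : ∑ x, p x = 1) (A : Finset (Fin m)) :
    ent 𝒳 p A ≤ ∑ i ∈ A, ent 𝒳 p {i} := by
  induction A using Finset.induction_on with
  | empty => simp [ent_empty hp1]
  | insert a s ha ih =>
    have h := ent_submodular hp0 {a} s
    rw [Finset.singleton_inter_of_notMem ha, ent_empty hp1, ← Finset.insert_eq] at h
    rw [Finset.sum_insert ha]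
    linarith

lemma ent_compl_add_le (hp0 : ∀ x, 0 ≤ p x) (S : Finset (Fin m)) :
    ent 𝒳 p Sᶜ + ((S.card : ℝ) - 1) * ent 𝒳 p Finset.univ ≤
      ∑ j ∈ S, ent 𝒳 p (Finset.univ.erase j) := by
  induction S using Finset.induction_on with
  | empty => simp
  | insert a s ha ih =>
    have h := ent_submodular hp0 sᶜ (Finset.univ.erase a)
    have hU : sᶜ ∪ Finset.univ.erase a = Finset.univ := by
      ext i
      by_cases hi : i = a <;> simp [hi, ha]
    have hI : sᶜ ∩ Finset.univ.erase a = (insert a s)ᶜ := by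
      ext i
      simp [and_comm]
    rw [hU, hI] at h
    rw [Finset.sum_insert ha, Finset.card_insert_of_notMem ha]
    push_cast
    linarith

end Entropy

/-- Sandwich between Watanabe's total correlation
C(X_M) = Σᵢ H(Xᵢ) − H(X_M) and Han's dual total correlation
D(X_M) = Σᵢ H(X_{M∖{i}}) − (m−1)·H(X_M):  C/(m−1) ≤ D ≤ (m−1)·C. -/
theorem totalCorrelation_dualTotalCorrelation_sandwich
    {m : ℕ} (hm : 2 ≤ m) (𝒳 : Fin m → Type) [∀ i, Fintype (𝒳 i)]
    (p : (∀ i, 𝒳 i) → ℝ) (hp0 : ∀ x, 0 ≤ p x) (hp1 : ∑ x, p x = 1) :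
    ((∑ i : Fin m, ent 𝒳 p {i}) - ent 𝒳 p Finset.univ) / ((m : ℝ) - 1)
        ≤ (∑ i : Fin m, ent 𝒳 p (Finset.univ.erase i)) - ((m : ℝ) - 1) * ent 𝒳 p Finset.univ
      ∧
    (∑ i : Fin m, ent 𝒳 p (Finset.univ.erase i)) - ((m : ℝ) - 1) * ent 𝒳 p Finset.univ
        ≤ ((m : ℝ) - 1) * ((∑ i : Fin m, ent 𝒳 p {i}) - ent 𝒳 p Finset.univ) := by
  have hsum (f : Fin m → ℝ) :
      ∑ i, ∑ j ∈ Finset.univ.erase i, f j = ((m : ℝ) - 1) * ∑ i, f i := by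
    simp only [Finset.sum_erase_eq_sub (Finset.mem_univ _), Finset.sum_sub_distrib,
      Finset.sum_const, Finset.card_univ, Fintype.card_fin, nsmul_eq_mul]
    ring
  have hm' : (2 : ℝ) ≤ m := by exact_mod_cast hm
  constructor
  · rw [div_le_iff₀ (by linarith)]
    have h (i : Fin m) : ent 𝒳 p {i} + ((m : ℝ) - 2) * ent 𝒳 p Finset.univ ≤
        ∑ j ∈ Finset.univ.erase i, ent 𝒳 p (Finset.univ.erase j) := by
      have h := ent_compl_add_le hp0 (Finset.univ.erase i)
      have hc : (Finset.univ.erase i)ᶜ = {i} := by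
        ext j
        simp
      rw [hc, Finset.card_erase_of_mem (Finset.mem_univ i), Finset.card_univ, Fintype.card_fin,
        Nat.cast_sub (by lia)] at h
      push_cast at h
      linarith
    have h' := Finset.sum_le_sum fun i (_ : i ∈ Finset.univ) => h i
    rw [hsum, Finset.sum_add_distrib, Finset.sum_const, Finset.card_univ, Fintype.card_fin,
      nsmul_eq_mul] at h'
    linarith
  · have h := Finset.sum_le_sum fun i (_ : i ∈ Finset.univ) =>
      ent_le_sum hp0 hp1 (Finset.univ.erase i)
    rw [hsum] at h
    linarith

end MCT
end
end
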